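/- arXiv:1210.1690 — 2 statements merged into one kernel-verified Lean document; each statement's English description precedes it below -/
import Mathlib

section
/- Let ν > 0, λ ≠ 0. Define f(t,x) as the unique solution of the renewal-type equation f(t,x) = G_ν(t,x)² + λ² ∫_0^t ∫_ℝ G_ν(t−s, x−y)² f(s,y) dy ds. Then f(t,x) = λ^{−2} K(t,x; ν, λ), where K(t,x; ν, λ) := G_{ν/2}(t,x)( λ²/√(4πνt) + (λ⁴/(2ν)) e^{λ⁴ t/(4ν)} Φ(λ²√(t/(2ν))) ). Equivalently, K satisfies the fixed-point identity K(t,x) = λ² G_ν(t,x)² + (K ⋆ λ²G_ν²)(t,x). -/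
open MeasureTheory Real Set Filter

/-- Standard normal CDF. -/
noncomputable def Phi (x : ℝ) : ℝ := ∫ y in Set.Iic x, Real.exp (-y^2/2) / Real.sqrt (2*Real.pi)

/-- Error function. -/
noncomputable def erf (x : ℝ) : ℝ := (2 / Real.sqrt Real.pi) * ∫ y in (0:ℝ)..x, Real.exp (-y^2)

/-- Complementary error function. -/
noncomputable def erfc (x : ℝ) : ℝ := 1 - erf x

/-- One-dimensional heat kernel with diffusion parameter ν. -/
noncomputable def G (ν t x : ℝ) : ℝ := (Real.sqrt (2*Real.pi*ν*t))⁻¹ * Real.exp (-x^2/(2*ν*t))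

/-- The kernel K(t,x;ν,λ). -/
noncomputable def K (ν lam t x : ℝ) : ℝ :=
  G (ν/2) t x * (lam^2 / Real.sqrt (4*Real.pi*ν*t)
    + lam^4/(2*ν) * Real.exp (lam^4*t/(4*ν)) * Phi (lam^2 * Real.sqrt (t/(2*ν))))

/-- The function H(t;ν,λ). -/
noncomputable def Hfun (ν lam t : ℝ) : ℝ :=
  2 * Real.exp (lam^4*t/(4*ν)) * Phi (lam^2 * Real.sqrt (t/(2*ν))) - 1

/-- The density `1 / √(π s)` of the fractional integral of order `1 / 2`; it vanishes for `s ≤ 0`. -/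
noncomputable def halfKernel (s : ℝ) : ℝ := (√(π * s))⁻¹

lemma halfKernel_of_nonpos {s : ℝ} (hs : s ≤ 0) : halfKernel s = 0 := by
  rw [halfKernel, sqrt_eq_zero_of_nonpos (mul_nonpos_of_nonneg_of_nonpos pi_pos.le hs), inv_zero]

lemma halfKernel_nonneg (s : ℝ) : 0 ≤ halfKernel s := inv_nonneg.2 (sqrt_nonneg _)

lemma halfKernel_eq {s : ℝ} : halfKernel s = (√π)⁻¹ * (√s)⁻¹ := by
  rw [halfKernel, sqrt_mul pi_pos.le, mul_inv]

lemma hasDerivAt_arcsin_div_pi {w s : ℝ} (hs : s ∈ Ioo 0 w) :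
    HasDerivAt (fun s => arcsin (2 * s / w - 1) / π) (halfKernel s * halfKernel (w - s)) s := by
  obtain ⟨h0, h1⟩ := hs
  have hw : 0 < w := h0.trans h1
  have hws : 0 < w - s := sub_pos.2 h1
  have hlin : HasDerivAt (fun s : ℝ => 2 * s / w - 1) (2 / w) s := by
    simpa using (((hasDerivAt_id s).const_mul 2).div_const w).sub_const 1
  have hlt : 2 * s / w < 2 := by rw [div_lt_iff₀ hw]; linarith
  have hpos : 0 < 2 * s / w := by positivity
  have hd := ((hasDerivAt_arcsin (x := 2 * s / w - 1) (by linarith) (by linarith)).comp s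
    hlin).div_const π
  convert! hd using 1
  have key : 1 - (2 * s / w - 1) ^ 2 = (2 / w) ^ 2 * (s * (w - s)) := by
    field_simp
    ring
  rw [key, sqrt_mul (by positivity), sqrt_sq (by positivity), sqrt_mul h0.le, halfKernel_eq,
    halfKernel_eq]
  have h2 : 0 < √s := sqrt_pos.2 h0
  have h3 : 0 < √(w - s) := sqrt_pos.2 hws
  have h4 : 0 < √π := sqrt_pos.2 pi_pos
  have h5 : √π ^ 2 = π := sq_sqrt pi_pos.le
  field_simp
  rw [h5]

lemma intervalIntegrable_halfKernel_mul {w : ℝ} (hw : 0 ≤ w) :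
    IntervalIntegrable (fun s => halfKernel s * halfKernel (w - s)) volume 0 w := by
  refine intervalIntegral.intervalIntegrable_deriv_of_nonneg
    (g := fun s => arcsin (2 * s / w - 1) / π) (by fun_prop) (fun s hs => ?_)
    (fun s _ => mul_nonneg (halfKernel_nonneg _) (halfKernel_nonneg _))
  rw [min_eq_left hw, max_eq_right hw] at hs
  exact hasDerivAt_arcsin_div_pi hs

lemma integral_halfKernel_mul {w : ℝ} (hw : 0 < w) :
    ∫ s in (0:ℝ)..w, halfKernel s * halfKernel (w - s) = 1 := by
  rw [intervalIntegral.integral_eq_sub_of_hasDerivAt_of_le hw.le (by fun_prop)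
    (fun s hs => hasDerivAt_arcsin_div_pi hs) (intervalIntegrable_halfKernel_mul hw.le)]
  have h1 : 2 * w / w - 1 = 1 := by field_simp; norm_num
  have hpi := pi_ne_zero
  simp only [h1, mul_zero, zero_div, zero_sub, arcsin_neg, arcsin_one]
  field_simp
  norm_num

lemma intervalIntegrable_halfKernel (t : ℝ) (ht : 0 ≤ t) :
    IntervalIntegrable halfKernel volume 0 t := by
  refine intervalIntegral.intervalIntegrable_deriv_of_nonneg
    (g := fun s => (√π)⁻¹ * (2 * √s)) (by fun_prop) (fun s hs => ?_)
    (fun s _ => halfKernel_nonneg _)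
  rw [min_eq_left ht] at hs
  have h := ((hasDerivAt_sqrt hs.1.ne').const_mul 2).const_mul (√π)⁻¹
  convert! h using 1
  rw [halfKernel_eq]
  field_simp

/-- Associativity of the convolution on `[0, t]` applied to `e`, `halfKernel`, `halfKernel`. -/
lemma integral_convolution_halfKernel {e : ℝ → ℝ} (he : Continuous e) {t : ℝ} (ht : 0 ≤ t) :
    ∫ s in (0:ℝ)..t, (∫ u in (0:ℝ)..(t - s), e (t - s - u) * halfKernel u) * halfKernel s
      = ∫ w in (0:ℝ)..t, e (t - w) := by
  set f : ℝ → ℝ := (Ioc 0 t).indicator halfKernel with hf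
  set c : ℝ → ℝ := (Ioc 0 t).indicator (fun w => e (t - w)) with hc
  have hf_eq : ∀ s, s ≤ t → f s = halfKernel s := by
    intro s hs
    by_cases h : 0 < s
    · exact indicator_of_mem (mem_Ioc.2 ⟨h, hs⟩) _
    · rw [hf, indicator_of_notMem (fun h' => h h'.1), halfKernel_of_nonpos (not_lt.1 h)]
  have hf_zero : ∀ s, s ≤ 0 → f s = 0 := fun s hs =>
    indicator_of_notMem (fun h' => not_lt.2 hs h'.1) _
  have hfi : Integrable f := by
    have := intervalIntegrable_halfKernel t ht
    rw [intervalIntegrable_iff_integrableOn_Ioc_of_le ht] at this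
    exact this.integrable_indicator measurableSet_Ioc
  have hcm : Measurable c := (he.comp (by fun_prop)).measurable.indicator measurableSet_Ioc
  obtain ⟨C, hC⟩ : ∃ C, ∀ w, ‖c w‖ ≤ C := by
    obtain ⟨C, hC⟩ := (isCompact_Icc (a := (0:ℝ)) (b := t)).exists_bound_of_continuousOn
      (f := fun w => e (t - w)) (by fun_prop)
    refine ⟨max C 0, fun w => ?_⟩
    by_cases hw : w ∈ Ioc 0 t
    · rw [hc, indicator_of_mem hw]
      exact (hC w (Ioc_subset_Icc_self hw)).trans (le_max_left _ _)
    · rw [hc, indicator_of_notMem hw, norm_zero]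
      exact le_max_right _ _
  have hint : Integrable (fun p : ℝ × ℝ => c p.1 * (f p.2 * f (p.1 - p.2)))
      (volume.prod volume) := by
    have := hfi.convolution_integrand (ContinuousLinearMap.mul ℝ ℝ) hfi
    simp only [ContinuousLinearMap.mul_apply'] at this
    exact this.bdd_mul (hcm.comp measurable_fst).aestronglyMeasurable
      (Eventually.of_forall fun p => hC p.1)
  have hswap := integral_integral_swap (f := fun w s => c w * (f s * f (w - s))) hint
  have hleft : ∫ w, ∫ s, c w * (f s * f (w - s)) = ∫ w in (0:ℝ)..t, e (t - w) := by
    rw [intervalIntegral.integral_of_le ht, ← integral_indicator measurableSet_Ioc]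
    refine integral_congr_ae (Eventually.of_forall fun w => ?_)
    dsimp only
    rw [integral_const_mul]
    by_cases hw : w ∈ Ioc 0 t
    · have hone : ∫ s, f s * f (w - s) = 1 := by
        rw [← integral_halfKernel_mul hw.1, intervalIntegral.integral_of_le hw.1.le,
          ← integral_indicator measurableSet_Ioc]
        refine integral_congr_ae (Eventually.of_forall fun s => ?_)
        dsimp only
        by_cases hs : s ∈ Ioc 0 w
        · rw [indicator_of_mem hs, hf_eq s (hs.2.trans hw.2),
            hf_eq (w - s) (by linarith [hs.1, hw.2])]
        · rw [indicator_of_notMem hs]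
          by_cases h : 0 < s
          · rw [hf_zero (w - s) (by by_contra hh; exact hs ⟨h, by linarith⟩), mul_zero]
          · rw [hf_zero s (not_lt.1 h), zero_mul]
      rw [hone, mul_one]
    · rw [hc, indicator_of_notMem hw, zero_mul]
  have hright : ∫ s, ∫ w, c w * (f s * f (w - s)) = ∫ s in (0:ℝ)..t,
      (∫ u in (0:ℝ)..(t - s), e (t - s - u) * halfKernel u) * halfKernel s := by
    rw [intervalIntegral.integral_of_le ht, ← integral_indicator measurableSet_Ioc]
    refine integral_congr_ae (Eventually.of_forall fun s => ?_)
    dsimp only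
    by_cases hs : s ∈ Ioc 0 t
    · rw [indicator_of_mem hs, ← hf_eq s hs.2, ← integral_add_right_eq_self _ s,
        intervalIntegral.integral_of_le (sub_nonneg.2 hs.2), ← integral_indicator measurableSet_Ioc,
        ← integral_mul_const]
      refine integral_congr_ae (Eventually.of_forall fun u => ?_)
      dsimp only
      rw [add_sub_cancel_right]
      by_cases hu : u ∈ Ioc 0 (t - s)
      · rw [indicator_of_mem hu, hf_eq u (by linarith [hu.2, hs.1]), hc,
          indicator_of_mem (mem_Ioc.2 ⟨by linarith [hu.1, hs.1], by linarith [hu.2]⟩),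
          show t - (u + s) = t - s - u by ring]
        ring
      · rw [indicator_of_notMem hu]
        by_cases h : 0 < u
        · rw [hc, indicator_of_notMem (fun hh => hu ⟨h, by linarith [hh.2]⟩)]
          ring
        · rw [hf_zero u (not_lt.1 h)]
          ring
    · rw [indicator_of_notMem hs, hf, indicator_of_notMem hs]
      simp
  rw [← hright, ← hleft, hswap]

lemma integrable_normal_density : Integrable fun y : ℝ => exp (-y^2/2) / √(2*π) := by
  have h := (integrable_exp_neg_mul_sq (b := 1/2) (by norm_num)).div_const (√(2*π))
  refine h.congr (Eventually.of_forall fun y => ?_)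
  dsimp only
  congr 2
  ring

lemma Phi_zero : Phi 0 = 1 / 2 := by
  have h : Phi 0 = ∫ y in Ioi (-0:ℝ), exp (-y^2/2) / √(2*π) := by
    rw [← integral_comp_neg_Iic, Phi]
    simp
  rw [h, neg_zero, integral_div]
  have h2 := integral_gaussian_Ioi (1/2)
  have h3 : ∀ y : ℝ, -y^2/2 = -(1/2) * y^2 := fun y => by ring
  simp_rw [h3, h2]
  rw [show π / (1/2) = 2 * π by ring]
  have : 0 < √(2 * π) := sqrt_pos.2 (by positivity)
  field_simp

lemma hasDerivAt_Phi (x : ℝ) : HasDerivAt Phi (exp (-x^2/2) / √(2*π)) x := by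
  have h : Phi = fun x => Phi 0 + ∫ y in (0:ℝ)..x, exp (-y^2/2) / √(2*π) := by
    funext z
    rw [← intervalIntegral.integral_Iic_sub_Iic integrable_normal_density.integrableOn
      integrable_normal_density.integrableOn]
    simp [Phi]
  rw [h]
  have hc : Continuous fun y : ℝ => exp (-y^2/2) / √(2*π) := by fun_prop
  exact (hc.integral_hasStrictDerivAt 0 x).hasDerivAt.const_add _

lemma continuous_Phi : Continuous Phi :=
  continuous_iff_continuousAt.2 fun x => (hasDerivAt_Phi x).continuousAt

lemma Phi_mul_sqrt {a r : ℝ} (hr : 0 ≤ r) :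
    Phi (a * √(2 * r)) =
      1 / 2 + a / 2 * ∫ u in (0:ℝ)..r, exp (-(a^2 * u)) * halfKernel u := by
  have hint : IntervalIntegrable (fun u => a / 2 * (exp (-(a^2 * u)) * halfKernel u))
      volume 0 r :=
    ((intervalIntegrable_halfKernel r hr).continuousOn_mul (by fun_prop)).const_mul _
  have hcont : Continuous fun u : ℝ => Phi (a * √(2 * u)) := continuous_Phi.comp (by fun_prop)
  have h := intervalIntegral.integral_eq_sub_of_hasDerivAt_of_le hr
    hcont.continuousOn (fun u hu => ?_) hint
  · rw [intervalIntegral.integral_const_mul] at h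
    simp only [mul_zero, sqrt_zero, Phi_zero] at h
    linarith
  · have hu0 : 0 < u := hu.1
    have hlin : HasDerivAt (fun u : ℝ => 2 * u) 2 u := by
      simpa using (hasDerivAt_id u).const_mul 2
    have hd := (hasDerivAt_Phi (a * √(2 * u))).comp u
      ((hlin.sqrt (by positivity)).const_mul a)
    convert! hd using 1
    rw [halfKernel_eq, mul_pow, sq_sqrt (by positivity), sqrt_mul zero_le_two,
      sqrt_mul zero_le_two, show -(a ^ 2 * (2 * u)) / 2 = -(a ^ 2 * u) by ring]
    have h2 : √2 ^ 2 = (2:ℝ) := sq_sqrt zero_le_two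
    have h3 : 0 < √u := sqrt_pos.2 hu0
    have h4 : 0 < √π := sqrt_pos.2 pi_pos
    have h5 : 0 < √(2:ℝ) := sqrt_pos.2 two_pos
    field_simp
    rw [h2]

/-- The time profile `a / √(π t) + 2 a² exp (a² t) Φ (a √(2 t))` solves a renewal equation with
kernel `a / √(π t)`. -/
lemma integral_profile_mul_halfKernel {a t : ℝ} (ha : a ≠ 0) (ht : 0 < t) :
    ∫ s in (0:ℝ)..t, (a * halfKernel (t - s)
        + 2 * a^2 * exp (a^2 * (t - s)) * Phi (a * √(2 * (t - s)))) * (a * halfKernel s)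
      = 2 * a^2 * exp (a^2 * t) * Phi (a * √(2 * t)) := by
  set I : ℝ → ℝ := fun r => ∫ u in (0:ℝ)..r, exp (a^2 * (r - u)) * halfKernel u with hI
  have hPhi : ∀ r, 0 ≤ r →
      exp (a^2 * r) * Phi (a * √(2 * r)) = exp (a^2 * r) / 2 + a / 2 * I r := by
    intro r hr
    rw [Phi_mul_sqrt hr, hI]
    dsimp only
    have : ∀ u, exp (a^2 * (r - u)) * halfKernel u
        = exp (a^2 * r) * (exp (-(a^2 * u)) * halfKernel u) := fun u => by
      rw [← mul_assoc, ← exp_add]; ring_nf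
    simp_rw [this]
    rw [intervalIntegral.integral_const_mul]
    ring
  have hg := intervalIntegrable_halfKernel t ht.le
  have hPc : Continuous fun s : ℝ => Phi (a * √(2 * (t - s))) :=
    continuous_Phi.comp (by fun_prop)
  have hEint : IntervalIntegrable
      (fun s => (exp (a^2 * (t - s)) * Phi (a * √(2 * (t - s)))) * halfKernel s) volume 0 t :=
    hg.continuousOn_mul (Continuous.continuousOn (by fun_prop))
  have heint : IntervalIntegrable (fun s => exp (a^2 * (t - s)) * halfKernel s) volume 0 t :=
    hg.continuousOn_mul (by fun_prop)
  have hassoc := integral_convolution_halfKernel (e := fun r => exp (a^2 * r)) (by fun_prop) ht.le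
  have hexp : ∫ w in (0:ℝ)..t, exp (a^2 * (t - w)) = (exp (a^2 * t) - 1) / a^2 := by
    rw [intervalIntegral.integral_comp_sub_left (fun w => exp (a^2 * w)),
      intervalIntegral.integral_comp_mul_left (fun w => exp w) (by positivity), integral_exp]
    simp
    ring
  have hE : ∫ s in (0:ℝ)..t, (exp (a^2 * (t - s)) * Phi (a * √(2 * (t - s)))) * halfKernel s
      = I t / 2 + (exp (a^2 * t) - 1) / (2 * a) := by
    have hmono : ∀ s ∈ uIcc 0 t,
        I (t - s) * halfKernel s = 2 / a *
          ((exp (a^2 * (t - s)) * Phi (a * √(2 * (t - s)))) * halfKernel s)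
          - 1 / a * (exp (a^2 * (t - s)) * halfKernel s) := by
      intro s hs
      rw [uIcc_of_le ht.le] at hs
      rw [hPhi (t - s) (sub_nonneg.2 hs.2)]
      field_simp
      ring
    have hsplit := intervalIntegral.integral_congr (μ := volume) hmono
    rw [intervalIntegral.integral_sub (hEint.const_mul _) (heint.const_mul _),
      intervalIntegral.integral_const_mul, intervalIntegral.integral_const_mul] at hsplit
    have hassoc' : ∫ s in (0:ℝ)..t, I (t - s) * halfKernel s = (exp (a^2 * t) - 1) / a^2 :=
      hassoc.trans hexp
    rw [hassoc'] at hsplit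
    have hIt : ∫ s in (0:ℝ)..t, exp (a^2 * (t - s)) * halfKernel s = I t := rfl
    rw [hIt] at hsplit
    field_simp at hsplit ⊢
    linarith
  have hfun : ∀ s, (a * halfKernel (t - s)
        + 2 * a^2 * exp (a^2 * (t - s)) * Phi (a * √(2 * (t - s)))) * (a * halfKernel s)
      = a^2 * (halfKernel s * halfKernel (t - s)) + 2 * a^3 *
        ((exp (a^2 * (t - s)) * Phi (a * √(2 * (t - s)))) * halfKernel s) := fun s => by ring
  simp_rw [hfun]
  rw [intervalIntegral.integral_add ((intervalIntegrable_halfKernel_mul ht.le).const_mul _)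
    (hEint.const_mul _), intervalIntegral.integral_const_mul, intervalIntegral.integral_const_mul,
    integral_halfKernel_mul ht, hE, mul_assoc (2 * a^2), hPhi t ht.le]
  field_simp
  ring

/-- Chapman–Kolmogorov identity for the heat kernel. -/
lemma integral_G_mul_G {μ r s : ℝ} (hμ : 0 < μ) (hr : 0 < r) (hs : 0 < s) (x : ℝ) :
    ∫ y : ℝ, G μ r (x - y) * G μ s y = G μ (r + s) x := by
  set b : ℝ := (r + s) / (2 * μ * r * s) with hb
  have hbpos : 0 < b := by positivity
  have hfun : ∀ y, G μ r (x - y) * G μ s y = ((√(2*π*μ*r))⁻¹ * (√(2*π*μ*s))⁻¹ *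
      exp (-x^2 / (2*μ*(r+s)))) * exp (-b * (y - s * x / (r + s))^2) := by
    intro y
    have hexp : -(x - y)^2 / (2*μ*r) + -y^2 / (2*μ*s)
        = -x^2 / (2*μ*(r+s)) + -b * (y - s * x / (r + s))^2 := by
      rw [hb]
      field_simp
      ring
    rw [mul_assoc _ (exp (-x^2 / (2*μ*(r+s)))), ← exp_add, ← hexp, exp_add, G, G]
    ring
  simp_rw [hfun]
  rw [integral_const_mul, integral_sub_right_eq_self (fun y => exp (-b * y^2)),
    integral_gaussian, G]
  have hsqrt : (√(2*π*μ*r))⁻¹ * (√(2*π*μ*s))⁻¹ * √(π / b) = (√(2*π*μ*(r+s)))⁻¹ := by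
    rw [← sqrt_inv, ← sqrt_inv, ← sqrt_inv, ← sqrt_mul (by positivity), ← sqrt_mul (by positivity)]
    congr 1
    rw [hb]
    field_simp
  rw [← hsqrt]
  ring

lemma G_sq {ν t : ℝ} (hν : 0 < ν) (ht : 0 < t) (x : ℝ) :
    G ν t x ^ 2 = G (ν/2) t x * ((2 * √ν)⁻¹ * halfKernel t) := by
  rw [G, G, halfKernel_eq, mul_pow, ← exp_nat_mul, inv_pow, sq_sqrt (by positivity),
    show 2*π*(ν/2)*t = π*(ν*t) by ring, sqrt_mul pi_pos.le, sqrt_mul hν.le]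
  have h : ((2:ℕ):ℝ) * (-x^2/(2*ν*t)) = -x^2/(2*(ν/2)*t) := by
    push_cast
    field_simp
  rw [h]
  have h1 : √ν ^ 2 = ν := sq_sqrt hν.le
  have h2 : √t ^ 2 = t := sq_sqrt ht.le
  have h3 : √π ^ 2 = π := sq_sqrt pi_pos.le
  have h4 : 2*π*ν*t = 2*√π^2*√ν^2*√t^2 := by rw [h1, h2, h3]
  rw [h4]
  have h5 : 0 < √ν := sqrt_pos.2 hν
  have h6 : 0 < √t := sqrt_pos.2 ht
  have h7 : 0 < √π := sqrt_pos.2 pi_pos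
  field_simp

lemma K_eq {ν t : ℝ} (lam : ℝ) (hν : 0 < ν) (ht : 0 < t) (x : ℝ) :
    K ν lam t x = G (ν/2) t x * (lam^2 / (2 * √ν) * halfKernel t
      + 2 * (lam^2 / (2 * √ν))^2 * exp ((lam^2 / (2 * √ν))^2 * t) *
        Phi (lam^2 / (2 * √ν) * √(2 * t))) := by
  have h1 : √ν ^ 2 = ν := sq_sqrt hν.le
  have hsq : (lam^2 / (2 * √ν))^2 = lam^4 / (4 * ν) := by
    rw [div_pow, mul_pow, h1]; ring
  have hsqrt : √(4*π*ν*t) = 2 * √ν * √(π * t) := by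
    rw [show 4*π*ν*t = 2^2 * (ν * (π * t)) by ring, sqrt_mul (by positivity),
      sqrt_sq zero_le_two, sqrt_mul hν.le, mul_assoc]
  have harg : lam^2 / (2 * √ν) * √(2 * t) = lam^2 * √(t / (2 * ν)) := by
    rw [show t / (2 * ν) = (2 * t) / (2^2 * ν) by field_simp, sqrt_div (by positivity),
      sqrt_mul (sq_nonneg 2) ν, sqrt_sq zero_le_two]
    ring
  rw [K, hsq, harg, hsqrt, halfKernel]
  congr 2
  · rw [← div_eq_mul_inv, div_div]
  · congr 2
    · ring
    · congr 1
      ring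

theorem K_renewal_equation (ν lam : ℝ) (hν : 0 < ν) (hlam : lam ≠ 0) (t x : ℝ) (ht : 0 < t) :
    K ν lam t x = lam^2 * (G ν t x)^2
      + ∫ s in (0:ℝ)..t, ∫ y : ℝ, K ν lam (t - s) (x - y) * (lam^2 * (G ν s y)^2) := by
  have hsν : 0 < √ν := sqrt_pos.2 hν
  set a : ℝ := lam^2 / (2 * √ν) with ha
  have ha0 : a ≠ 0 := by positivity
  have hinner : ∀ s ∈ Ioo 0 t,
      ∫ y : ℝ, K ν lam (t - s) (x - y) * (lam^2 * (G ν s y)^2) = G (ν/2) t x *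
        ((a * halfKernel (t - s) + 2 * a^2 * exp (a^2 * (t - s)) * Phi (a * √(2 * (t - s)))) *
          (a * halfKernel s)) := by
    intro s hs
    have hts : 0 < t - s := sub_pos.2 hs.2
    have hfun : ∀ y, K ν lam (t - s) (x - y) * (lam^2 * (G ν s y)^2) =
        (G (ν/2) (t - s) (x - y) * G (ν/2) s y) *
        ((a * halfKernel (t - s) + 2 * a^2 * exp (a^2 * (t - s)) * Phi (a * √(2 * (t - s)))) *
          (a * halfKernel s)) := by
      intro y
      rw [K_eq lam hν hts, G_sq hν hs.1, ← ha, show a * halfKernel s =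
        lam^2 * ((2 * √ν)⁻¹ * halfKernel s) by rw [ha]; ring]
      ring
    simp_rw [hfun]
    rw [integral_mul_const, integral_G_mul_G (half_pos hν) hts hs.1, sub_add_cancel]
  have houter : ∫ s in (0:ℝ)..t, ∫ y : ℝ, K ν lam (t - s) (x - y) * (lam^2 * (G ν s y)^2)
      = G (ν/2) t x * (2 * a^2 * exp (a^2 * t) * Phi (a * √(2 * t))) := by
    rw [← integral_profile_mul_halfKernel ha0 ht, ← intervalIntegral.integral_const_mul,
      intervalIntegral.integral_of_le ht.le, intervalIntegral.integral_of_le ht.le,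
      integral_Ioc_eq_integral_Ioo, integral_Ioc_eq_integral_Ioo]
    exact setIntegral_congr_fun measurableSet_Ioo hinner
  rw [houter, K_eq lam hν ht, G_sq hν ht, ← ha,
    show a * halfKernel t = lam^2 * ((2 * √ν)⁻¹ * halfKernel t) by rw [ha]; ring]
  ring
end

section
/- Fix ν > 0 and t > 0. The function g(s) := |x−y|/√(πνs³) · exp(−(x−y)²/(4νs) + (t−s)/(4ν)) · Φ(√((t−s)/(2ν))) satisfies ∫_0^t g(s) ds = exp((t − 2|x−y|)/(4ν)) · erfc((|x−y| − t)/√(4νt)) for all x ≠ y in ℝ. -/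
open MeasureTheory Real Set Filter

open Topology Function

section ErrorFunction

lemma hasDerivAt_erf (x : ℝ) : HasDerivAt erf (2 / √π * exp (-x ^ 2)) x := by
  have hc : Continuous fun y : ℝ => exp (-y ^ 2) := by fun_prop
  exact (intervalIntegral.integral_hasDerivAt_right (hc.intervalIntegrable _ _)
    hc.stronglyMeasurable.stronglyMeasurableAtFilter hc.continuousAt).const_mul _

lemma erf_neg (x : ℝ) : erf (-x) = -erf x := by
  have h := intervalIntegral.integral_comp_neg (a := 0) (b := x) fun y : ℝ => exp (-y ^ 2)
  simp only [neg_sq, neg_zero] at h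
  rw [erf, erf, h, intervalIntegral.integral_symm, mul_neg]

lemma tendsto_erf_atTop : Tendsto erf atTop (𝓝 1) := by
  have hi : IntegrableOn (fun y : ℝ => exp (-y ^ 2)) (Ioi 0) := by
    simpa using (integrable_exp_neg_mul_sq one_pos).integrableOn (s := Ioi 0)
  have h := (intervalIntegral_tendsto_integral_Ioi 0 hi tendsto_id).const_mul (2 / √π)
  have hg := integral_gaussian_Ioi 1
  simp only [neg_mul, one_mul, div_one] at hg
  rw [hg] at h
  convert! h using 2
  have : √π ≠ 0 := by positivity
  field_simp

lemma tendsto_erf_atBot : Tendsto erf atBot (𝓝 (-1)) := by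
  have h := (tendsto_erf_atTop.comp tendsto_neg_atBot_atTop).neg
  refine h.congr fun x => ?_
  simp [erf_neg]

lemma Phi_eq_erf (x : ℝ) : Phi x = (1 + erf (x / √2)) / 2 := by
  have hderiv : ∀ y ∈ Ici (-x), HasDerivAt (fun y => erf (y / √2) / 2)
      (exp (-y ^ 2 / 2) / √(2 * π)) y := by
    intro y _
    have h := ((hasDerivAt_erf (y / √2)).comp y ((hasDerivAt_id y).div_const √2)).div_const 2
    refine h.congr_deriv ?_
    rw [div_pow, sq_sqrt zero_le_two, sqrt_mul zero_le_two, neg_div]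
    field_simp
  have hlim : Tendsto (fun y => erf (y / √2) / 2) atTop (𝓝 (1 / 2)) :=
    (tendsto_erf_atTop.comp (tendsto_id.atTop_div_const (by positivity))).div_const 2
  have h := integral_Ioi_of_hasDerivAt_of_nonneg' hderiv (fun y _ => by positivity) hlim
  have hneg := integral_comp_neg_Ioi (-x) fun y : ℝ => exp (-y ^ 2 / 2) / √(2 * π)
  simp only [neg_sq, neg_neg] at hneg
  rw [Phi, ← hneg, h, neg_div, erf_neg]
  ring

end ErrorFunction

section HeatKernel

/-- Antiderivative of the exponentially tilted, shifted heat kernel. -/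
lemma hasDerivAt_tilted_heatKernel {t : ℝ} (ht : 0 < t) (b c z : ℝ) :
    HasDerivAt (fun z => exp (b ^ 2 * t - b * c) / 2 * erf ((z + c - 2 * b * t) / (2 * √t)))
      (exp (b * z) * (exp (-(c + z) ^ 2 / (4 * t)) / (2 * √π * √t))) z := by
  have hin : HasDerivAt (fun z => (z + c - 2 * b * t) / (2 * √t)) (1 / (2 * √t)) z :=
    (((hasDerivAt_id z).add_const c).sub_const _).div_const _
  refine (((hasDerivAt_erf _).comp z hin).const_mul _).congr_deriv ?_
  have hexp : exp (b * z) * exp (-(c + z) ^ 2 / (4 * t)) =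
      exp (b ^ 2 * t - b * c) * exp (-((z + c - 2 * b * t) / (2 * √t)) ^ 2) := by
    rw [← exp_add, ← exp_add, div_pow, mul_pow, sq_sqrt ht.le]
    congr 1
    field_simp
    ring
  rw [← mul_div_assoc (exp (b * z)), hexp]
  field_simp

lemma tendsto_tilted_heatKernel {t : ℝ} (ht : 0 < t) (b c : ℝ) :
    Tendsto (fun z => exp (b ^ 2 * t - b * c) / 2 * erf ((z + c - 2 * b * t) / (2 * √t)))
      atTop (𝓝 (exp (b ^ 2 * t - b * c) / 2)) := by
  have hin : Tendsto (fun z : ℝ => (z + c - 2 * b * t) / (2 * √t)) atTop atTop := by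
    refine Tendsto.atTop_div_const (by positivity) ?_
    simp only [add_sub_assoc]
    exact tendsto_atTop_add_const_right _ _ tendsto_id
  simpa using (tendsto_erf_atTop.comp hin).const_mul (exp (b ^ 2 * t - b * c) / 2)

lemma integrableOn_tilted_heatKernel {t : ℝ} (ht : 0 < t) (b c : ℝ) :
    IntegrableOn (fun z => exp (b * z) * (exp (-(c + z) ^ 2 / (4 * t)) / (2 * √π * √t)))
      (Ioi 0) :=
  integrableOn_Ioi_deriv_of_nonneg' (fun z _ => hasDerivAt_tilted_heatKernel ht b c z)
    (fun z _ => by positivity) (tendsto_tilted_heatKernel ht b c)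

lemma integral_tilted_heatKernel {t : ℝ} (ht : 0 < t) (b c : ℝ) :
    ∫ z in Ioi 0, exp (b * z) * (exp (-(c + z) ^ 2 / (4 * t)) / (2 * √π * √t)) =
      exp (b ^ 2 * t - b * c) / 2 * erfc ((c - 2 * b * t) / (2 * √t)) := by
  rw [integral_Ioi_of_hasDerivAt_of_nonneg' (fun z _ => hasDerivAt_tilted_heatKernel ht b c z)
    (fun z _ => by positivity) (tendsto_tilted_heatKernel ht b c), erfc, zero_add]
  ring

lemma integral_tilted_heatKernel_zero {t : ℝ} (ht : 0 < t) (b : ℝ) :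
    ∫ z in Ioi 0, exp (b * z) * (exp (-z ^ 2 / (4 * t)) / (2 * √π * √t)) =
      exp (b ^ 2 * t) * Phi (b * √t * √2) := by
  have h := integral_tilted_heatKernel ht b 0
  have harg : (0 - 2 * b * t) / (2 * √t) = -(b * √t) := by
    have : t = √t * √t := (mul_self_sqrt ht.le).symm
    rw [div_eq_iff (by positivity)]
    linear_combination (-2 * b) * this
  simp only [zero_add, mul_zero, sub_zero] at h
  rw [h, harg, erfc, erf_neg, Phi_eq_erf, mul_div_cancel_right₀ _ (by positivity)]
  ring

end HeatKernel

/-- A nonnegative derivative on an open interval is integrable as soon as the function has limits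
at both endpoints, and its integral is the difference of the limits. -/
lemma integrableOn_and_integral_Ioo_of_hasDerivAt_of_nonneg {f f' : ℝ → ℝ} {a b fa fb : ℝ}
    (hab : a < b) (hderiv : ∀ x ∈ Ioo a b, HasDerivAt f (f' x) x)
    (hpos : ∀ x ∈ Ioo a b, 0 ≤ f' x)
    (ha : Tendsto f (𝓝[>] a) (𝓝 fa)) (hb : Tendsto f (𝓝[<] b) (𝓝 fb)) :
    IntegrableOn f' (Ioo a b) ∧ ∫ x in Ioo a b, f' x = fb - fa := by
  have hcont : ContinuousOn (extendFrom (Ioo a b) f) (Icc a b) :=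
    continuousOn_Icc_extendFrom_Ioo
      (fun x hx => (hderiv x hx).continuousAt.continuousWithinAt) ha hb
  have hext : ∀ x ∈ Ioo a b, HasDerivAt (extendFrom (Ioo a b) f) (f' x) x := by
    refine fun x hx => (hderiv x hx).congr_of_eventuallyEq ?_
    filter_upwards [Ioo_mem_nhds hx.1 hx.2] with y hy
    exact extendFrom_extends
      (fun z hz => (hderiv z hz).continuousAt.continuousWithinAt) y hy
  have hint := intervalIntegral.integrableOn_deriv_of_nonneg hcont hext hpos
  refine ⟨hint.mono_set Ioo_subset_Ioc_self, ?_⟩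
  rw [← integral_Ioc_eq_integral_Ioo, ← intervalIntegral.integral_of_le hab.le]
  exact intervalIntegral.integral_eq_sub_of_hasDerivAt_of_tendsto hab hderiv
    ((intervalIntegrable_iff_integrableOn_Ioc_of_le hab.le).2 hint) ha hb

section FirstPassage

lemma hasDerivAt_firstPassage_arg {s t : ℝ} (hs : s ∈ Ioo 0 t) (c z : ℝ) :
    HasDerivAt (fun s => (c * (√(t - s) / √s) + z * (√s / √(t - s))) / (2 * √t))
      ((-c * (t / (2 * √(t - s) * √s ^ 3)) + z * (t / (2 * √s * √(t - s) ^ 3))) / (2 * √t)) s := by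
  obtain ⟨hs0, hst⟩ := hs
  have hts : 0 < t - s := sub_pos.2 hst
  have hP : HasDerivAt (fun s : ℝ => √s) (1 / (2 * √s)) s := hasDerivAt_sqrt hs0.ne'
  have hQ : HasDerivAt (fun s : ℝ => √(t - s)) (-1 / (2 * √(t - s))) s :=
    ((hasDerivAt_id s).const_sub t).sqrt hts.ne'
  have hPpos : 0 < √s := sqrt_pos.2 hs0
  have hQpos : 0 < √(t - s) := sqrt_pos.2 hts
  have h := (((hQ.div hP hPpos.ne').const_mul c).add
    ((hP.div hQ hQpos.ne').const_mul z)).div_const (2 * √t)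
  refine h.congr_deriv ?_
  have ht : t = √(t - s) ^ 2 + √s ^ 2 := by rw [sq_sqrt hts.le, sq_sqrt hs0.le]; ring
  congr 1
  generalize √(t - s) = Q at *
  generalize √s = P at *
  rw [ht]
  field_simp
  ring

/-- The convolution of the first passage density to level `c` with the heat kernel. -/
lemma integrableOn_and_integral_firstPassage_mul_heatKernel {c z t : ℝ} (hc : 0 < c) (hz : 0 < z)
    (ht : 0 < t) :
    IntegrableOn (fun s => c / (2 * √π * √s ^ 3) * exp (-c ^ 2 / (4 * s)) *
      (exp (-z ^ 2 / (4 * (t - s))) / (2 * √π * √(t - s)))) (Ioo 0 t) ∧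
    ∫ s in Ioo 0 t, c / (2 * √π * √s ^ 3) * exp (-c ^ 2 / (4 * s)) *
      (exp (-z ^ 2 / (4 * (t - s))) / (2 * √π * √(t - s))) =
      exp (-(c + z) ^ 2 / (4 * t)) / (2 * √π * √t) := by
  have hsum : exp (-(c + z) ^ 2 / (4 * t)) / (2 * √π * √t) =
      -(1 / (4 * √π * √t)) * (exp (-(c - z) ^ 2 / (4 * t)) * 1 +
        exp (-(c + z) ^ 2 / (4 * t)) * (-1)) -
      -(1 / (4 * √π * √t)) * (exp (-(c - z) ^ 2 / (4 * t)) * 1 +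
        exp (-(c + z) ^ 2 / (4 * t)) * 1) := by
    field_simp
    ring
  rw [hsum]
  have hzero : Tendsto (fun s : ℝ => √(t - s) / √s) (𝓝[>] 0) atTop := by
    have h1 : Tendsto (fun s : ℝ => √(t - s)) (𝓝[>] 0) (𝓝 √(t - 0)) :=
      (Continuous.tendsto (by fun_prop) 0).mono_left nhdsWithin_le_nhds
    have h2 : Tendsto (fun s : ℝ => √s) (𝓝[>] 0) (𝓝[>] 0) := by
      refine tendsto_nhdsWithin_iff.2 ⟨?_, ?_⟩
      · simpa using (continuous_sqrt.tendsto 0).mono_left (nhdsWithin_le_nhds (s := Ioi 0))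
      · filter_upwards [self_mem_nhdsWithin] with s hs using sqrt_pos.2 hs
    exact h1.pos_mul_atTop (by simpa using sqrt_pos.2 ht) (tendsto_inv_nhdsGT_zero.comp h2)
  have hzero' : Tendsto (fun s : ℝ => √s / √(t - s)) (𝓝[>] 0) (𝓝 0) := by
    refine hzero.inv_tendsto_atTop.congr fun s => ?_
    simp
  have hend : Tendsto (fun s : ℝ => √s / √(t - s)) (𝓝[<] t) atTop := by
    have h1 : Tendsto (fun s : ℝ => √s) (𝓝[<] t) (𝓝 √t) :=
      (continuous_sqrt.tendsto t).mono_left nhdsWithin_le_nhds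
    have h2 : Tendsto (fun s : ℝ => √(t - s)) (𝓝[<] t) (𝓝[>] 0) := by
      refine tendsto_nhdsWithin_iff.2 ⟨?_, ?_⟩
      · have : Continuous fun s : ℝ => √(t - s) := by fun_prop
        simpa using (this.tendsto t).mono_left (nhdsWithin_le_nhds (s := Iio t))
      · filter_upwards [self_mem_nhdsWithin] with s hs using sqrt_pos.2 (sub_pos.2 hs)
    exact h1.pos_mul_atTop (sqrt_pos.2 ht) (tendsto_inv_nhdsGT_zero.comp h2)
  have hend' : Tendsto (fun s : ℝ => √(t - s) / √s) (𝓝[<] t) (𝓝 0) := by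
    refine hend.inv_tendsto_atTop.congr fun s => ?_
    simp
  have harg_zero : ∀ w : ℝ, Tendsto
      (fun s => (c * (√(t - s) / √s) + w * (√s / √(t - s))) / (2 * √t)) (𝓝[>] 0) atTop :=
    fun w => ((hzero.const_mul_atTop hc).atTop_add (hzero'.const_mul w)).atTop_div_const
      (by positivity)
  have harg_end : Tendsto
      (fun s => (c * (√(t - s) / √s) + z * (√s / √(t - s))) / (2 * √t)) (𝓝[<] t) atTop :=
    ((hend'.const_mul c).add_atTop (hend.const_mul_atTop hz)).atTop_div_const (by positivity)
  have harg_end' : Tendsto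
      (fun s => (c * (√(t - s) / √s) + -z * (√s / √(t - s))) / (2 * √t)) (𝓝[<] t) atBot :=
    ((hend'.const_mul c).add_atBot
      (hend.const_mul_atTop_of_neg (neg_neg_of_pos hz))).atBot_div_const (by positivity)
  refine integrableOn_and_integral_Ioo_of_hasDerivAt_of_nonneg (f := fun s =>
      -(1 / (4 * √π * √t)) * (exp (-(c - z) ^ 2 / (4 * t)) *
        erf ((c * (√(t - s) / √s) + z * (√s / √(t - s))) / (2 * √t)) +
        exp (-(c + z) ^ 2 / (4 * t)) *
        erf ((c * (√(t - s) / √s) + -z * (√s / √(t - s))) / (2 * √t)))) ht ?_ ?_ ?_ ?_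
  · intro s hs
    have h1 := (hasDerivAt_erf _).comp s (hasDerivAt_firstPassage_arg hs c z)
    have h2 := (hasDerivAt_erf _).comp s (hasDerivAt_firstPassage_arg hs c (-z))
    refine (((h1.const_mul _).add (h2.const_mul _)).const_mul _).congr_deriv ?_
    obtain ⟨hs0, hst⟩ := hs
    have hts : 0 < t - s := sub_pos.2 hst
    have hexp : ∀ w : ℝ, exp (-(c - w) ^ 2 / (4 * t)) *
        exp (-((c * (√(t - s) / √s) + w * (√s / √(t - s))) / (2 * √t)) ^ 2) =
        exp (-c ^ 2 / (4 * s)) * exp (-w ^ 2 / (4 * (t - s))) := by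
      intro w
      rw [← exp_add, ← exp_add, div_pow, mul_pow, sq_sqrt ht.le]
      congr 1
      have hsq : (c * (√(t - s) / √s) + w * (√s / √(t - s))) ^ 2 =
          c ^ 2 * ((t - s) / s) + w ^ 2 * (s / (t - s)) + 2 * c * w := by
        have e1 : (√(t - s) / √s) ^ 2 = (t - s) / s := by
          rw [div_pow, sq_sqrt hts.le, sq_sqrt hs0.le]
        have e2 : (√s / √(t - s)) ^ 2 = s / (t - s) := by
          rw [div_pow, sq_sqrt hts.le, sq_sqrt hs0.le]
        have e3 : (√(t - s) / √s) * (√s / √(t - s)) = 1 := by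
          have := sqrt_pos.2 hs0
          have := sqrt_pos.2 hts
          field_simp
        linear_combination c ^ 2 * e1 + w ^ 2 * e2 + 2 * c * w * e3
      rw [hsq]
      have := hts.ne'
      field_simp
      ring
    have e1 := hexp z
    have e2 := hexp (-z)
    rw [sub_neg_eq_add, neg_sq] at e2
    have hP : 0 < √s := sqrt_pos.2 hs0
    have hQ : 0 < √(t - s) := sqrt_pos.2 hts
    have hR : √t ≠ 0 := (sqrt_pos.2 ht).ne'
    have hR2 : √t ^ 2 = t := sq_sqrt ht.le
    have hpi : √π ≠ 0 := by positivity
    trans -(1 / (4 * √π * √t)) * (2 / √π) *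
      ((exp (-c ^ 2 / (4 * s)) * exp (-z ^ 2 / (4 * (t - s)))) *
        (-c * (t / (2 * √(t - s) * √s ^ 3)) / √t))
    · linear_combination (-(1 / (4 * √π * √t)) * (2 / √π)) *
        ((-c * (t / (2 * √(t - s) * √s ^ 3)) + z * (t / (2 * √s * √(t - s) ^ 3))) / (2 * √t) * e1 +
        (-c * (t / (2 * √(t - s) * √s ^ 3)) + -z * (t / (2 * √s * √(t - s) ^ 3))) / (2 * √t) * e2)
    · field_simp
      rw [hR2]
      ring
  · intro s hs
    have hs0 := hs.1
    positivity
  · exact (((tendsto_erf_atTop.comp (harg_zero z)).const_mul _).add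
      ((tendsto_erf_atTop.comp (harg_zero (-z))).const_mul _)).const_mul _
  · exact (((tendsto_erf_atTop.comp harg_end).const_mul _).add
      ((tendsto_erf_atBot.comp harg_end').const_mul _)).const_mul _

/-- Convolution of the first passage density to level `c` with the heat kernel tilted by `b` and
integrated over the half-line. -/
lemma integral_firstPassage_mul_exp_mul_Phi {c t : ℝ} (hc : 0 < c) (ht : 0 < t) (b : ℝ) :
    ∫ s in Ioo 0 t, c / (2 * √π * √s ^ 3) * exp (-c ^ 2 / (4 * s)) *
      (exp (b ^ 2 * (t - s)) * Phi (b * √(t - s) * √2)) =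
      exp (b ^ 2 * t - b * c) / 2 * erfc ((c - 2 * b * t) / (2 * √t)) := by
  let F : ℝ → ℝ → ℝ := fun s z => exp (b * z) * (c / (2 * √π * √s ^ 3) * exp (-c ^ 2 / (4 * s)) *
    (exp (-z ^ 2 / (4 * (t - s))) / (2 * √π * √(t - s))))
  have hinner : ∀ z ∈ Ioi (0 : ℝ), ∫ s in Ioo 0 t, F s z =
      exp (b * z) * (exp (-(c + z) ^ 2 / (4 * t)) / (2 * √π * √t)) := by
    intro z hz
    rw [integral_const_mul, (integrableOn_and_integral_firstPassage_mul_heatKernel hc hz ht).2]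
  have hint : Integrable (uncurry F)
      ((volume.restrict (Ioo 0 t)).prod (volume.restrict (Ioi 0))) := by
    have hmeas : Measurable (uncurry F) := by
      simp only [F, uncurry_def]
      fun_prop
    refine (integrable_prod_iff' hmeas.aestronglyMeasurable).2 ⟨?_, ?_⟩
    · filter_upwards [ae_restrict_mem measurableSet_Ioi] with z hz
      exact (integrableOn_and_integral_firstPassage_mul_heatKernel hc hz ht).1.const_mul
        (exp (b * z))
    · refine (integrableOn_tilted_heatKernel ht b c).congr ?_
      filter_upwards [ae_restrict_mem measurableSet_Ioi] with z hz
      rw [← hinner z hz]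
      refine integral_congr_ae (ae_of_all _ fun s => ?_)
      refine (norm_of_nonneg ?_).symm
      simp only [F]
      positivity
  rw [← integral_tilted_heatKernel ht, ← setIntegral_congr_fun measurableSet_Ioi hinner,
    ← integral_integral_swap hint]
  refine setIntegral_congr_fun measurableSet_Ioo fun s hs => ?_
  simp only [F]
  rw [← integral_tilted_heatKernel_zero (sub_pos.2 hs.2), ← integral_const_mul]
  congr 1 with z
  ring

end FirstPassage

theorem bertini_cancrini_integral (ν t : ℝ) (hν : 0 < ν) (ht : 0 < t) (x y : ℝ) (hxy : x ≠ y) :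
    ∫ s in (0:ℝ)..t,
        |x - y| / Real.sqrt (Real.pi*ν*s^3)
          * Real.exp (-(x - y)^2/(4*ν*s) + (t - s)/(4*ν))
          * Phi (Real.sqrt ((t - s)/(2*ν)))
      = Real.exp ((t - 2*|x - y|)/(4*ν)) * erfc ((|x - y| - t) / Real.sqrt (4*ν*t)) := by
  have hd : 0 < |x - y| := abs_pos.2 (sub_ne_zero.2 hxy)
  have hν' : 0 < √ν := sqrt_pos.2 hν
  have hν2 : √ν ^ 2 = ν := sq_sqrt hν.le
  have hb2 : (1 / (2 * √ν)) ^ 2 = 1 / (4 * ν) := by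
    rw [div_pow, mul_pow, hν2]; norm_num
  have hbc : 1 / (2 * √ν) * (|x - y| / √ν) = |x - y| / (2 * ν) := by
    rw [div_mul_div_comm, one_mul, mul_assoc, ← sq, hν2]
  have key := integral_firstPassage_mul_exp_mul_Phi (div_pos hd hν') ht (1 / (2 * √ν))
  have hsqrt : √(4 * ν * t) = 2 * √ν * √t := by
    rw [sqrt_mul (by positivity), sqrt_mul (by norm_num), show (4 : ℝ) = 2 ^ 2 by norm_num,
      sqrt_sq zero_le_two]
  have harg : (|x - y| / √ν - 2 * (1 / (2 * √ν)) * t) / (2 * √t) =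
      (|x - y| - t) / √(4 * ν * t) := by
    rw [hsqrt]
    field_simp
  have hexp : (1 / (2 * √ν)) ^ 2 * t - 1 / (2 * √ν) * (|x - y| / √ν) =
      (t - 2 * |x - y|) / (4 * ν) := by
    rw [hb2, hbc]
    field_simp
    ring
  rw [harg, hexp] at key
  rw [intervalIntegral.integral_of_le ht.le, integral_Ioc_eq_integral_Ioo]
  trans 2 * (exp ((t - 2 * |x - y|) / (4 * ν)) / 2 * erfc ((|x - y| - t) / √(4 * ν * t)))
  swap
  · ring
  rw [← key, ← integral_const_mul]
  refine setIntegral_congr_fun measurableSet_Ioo fun s hs => ?_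
  have hs0 : 0 < s := hs.1
  have hts : 0 < t - s := sub_pos.2 hs.2
  have hPhi : √((t - s) / (2 * ν)) = 1 / (2 * √ν) * √(t - s) * √2 := by
    rw [sqrt_div hts.le, sqrt_mul zero_le_two]
    have h2 : √2 * √2 = 2 := mul_self_sqrt zero_le_two
    field_simp
    linarith
  have hden : √(π * ν * s ^ 3) = √π * √ν * √s ^ 3 := by
    rw [sqrt_mul (by positivity), sqrt_mul pi_pos.le]
    congr 1
    rw [sqrt_eq_iff_mul_self_eq (by positivity) (by positivity)]
    calc s ^ 3 = (√s ^ 2) ^ 3 := by rw [sq_sqrt hs0.le]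
      _ = √s ^ 3 * √s ^ 3 := by ring
  have hquad : -(|x - y| / √ν) ^ 2 / (4 * s) = -(x - y) ^ 2 / (4 * ν * s) := by
    rw [div_pow, sq_abs, hν2]
    field_simp
  rw [hPhi, hden, hquad, hb2, exp_add, one_div_mul_eq_div]
  field_simp
end
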